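/- Fix β > 0, d ≥ 1, and ε with 1 − (1 − 2Q(1/(2β)))^d < ε ≤ 1. Let k_* = ⌊1/(β Q^{−1}((1 − (1−ε)^{1/d})/2))⌋. Then the bias of the plug-in entropy estimator over the class F_d of distributions supported in [−1,1]^d satisfies sup_{P∈F_d} |h(P∗φ_β) − E h(P̂_{S^n}∗φ_β)| ≥ log(k_*^{d(1−ε)}/n) − H_b(ε), where H_b is the binary entropy function. -/

import Mathlib

open MeasureTheory Real

/-- The density of the Gaussian `N(μ, β²I_d)` on `ℝ^d`. -/
noncomputable def gaussPdf {d : ℕ} (β : ℝ) (μ t : EuclideanSpace ℝ (Fin d)) : ℝ :=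
  (2 * π * β ^ 2) ^ (-(d : ℝ) / 2) * Real.exp (-‖t - μ‖ ^ 2 / (2 * β ^ 2))

/-- Differential entropy `h(g) = −∫ g log g` of a density on `ℝ^d`. -/
noncomputable def diffEnt {d : ℕ} (g : EuclideanSpace ℝ (Fin d) → ℝ) : ℝ :=
  -∫ t, g t * Real.log (g t)

/-- The Gaussian tail function `Q(x) = (2π)^{-1/2} ∫_x^∞ e^{−t²/2} dt`. -/
noncomputable def Qfun (x : ℝ) : ℝ :=
  ∫ t in Set.Ioi x, (Real.sqrt (2 * π))⁻¹ * Real.exp (-t ^ 2 / 2)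

/-- The binary entropy function. -/
noncomputable def binEnt (ε : ℝ) : ℝ := -(ε * Real.log ε + (1 - ε) * Real.log (1 - ε))

/-- The class `F_d` of probability distributions supported in `[−1,1]^d`. -/
def cubeClass (d : ℕ) : Set (Measure (EuclideanSpace ℝ (Fin d))) :=
  {P | IsProbabilityMeasure P ∧ ∀ᵐ x ∂P, ∀ j, |x j| ≤ 1}

/-- Bias of the plug-in (sample propagation) estimator:
`h(P ∗ φ_β) − E[h(P̂_{S^n} ∗ φ_β)]` for `n` i.i.d. samples `S^n ~ P^{⊗n}`. -/
noncomputable def spBias (d n : ℕ) (β : ℝ) (P : Measure (EuclideanSpace ℝ (Fin d))) : ℝ :=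
  diffEnt (fun t => ∫ s, gaussPdf β s t ∂P) -
    ∫ s : Fin n → EuclideanSpace ℝ (Fin d),
      diffEnt (fun t => (n : ℝ)⁻¹ * ∑ i, gaussPdf β (s i) t) ∂(Measure.pi fun _ => P)

section

/-! ### One-dimensional facts -/

/-- standard normal density -/
noncomputable def gstd (t : ℝ) : ℝ := (Real.sqrt (2 * π))⁻¹ * Real.exp (-t ^ 2 / 2)

lemma gstd_nonneg (t : ℝ) : 0 ≤ gstd t := by unfold gstd; positivity

lemma gstd_eq (t : ℝ) : gstd t = (Real.sqrt (2 * π))⁻¹ * Real.exp (-(1/2) * t ^ 2) := by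
  unfold gstd; congr 2; ring

lemma gstd_cont : Continuous gstd := by unfold gstd; fun_prop

lemma gstd_integrable : Integrable gstd := by
  have h : gstd = fun t => (Real.sqrt (2 * π))⁻¹ * Real.exp (-(1/2) * t ^ 2) := funext gstd_eq
  rw [h]
  exact (integrable_exp_neg_mul_sq (by norm_num : (0:ℝ) < 1/2)).const_mul _

lemma gstd_integral : ∫ t, gstd t = 1 := by
  simp_rw [gstd_eq]
  rw [integral_const_mul, integral_gaussian]
  have : π / (1/2) = 2 * π := by ring
  rw [this]
  have : 0 < √(2 * π) := by positivity
  field_simp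

lemma Qfun_eq (x : ℝ) : Qfun x = ∫ t in Set.Ioi x, gstd t := rfl

lemma Qfun_zero : Qfun 0 = 1 / 2 := by
  rw [Qfun_eq]
  simp_rw [gstd_eq]
  rw [integral_const_mul, integral_gaussian_Ioi]
  have : π / (1/2) = 2 * π := by ring
  rw [this]
  have : 0 < √(2 * π) := by positivity
  field_simp

lemma Qfun_nonneg (x : ℝ) : 0 ≤ Qfun x := by
  rw [Qfun_eq]; exact integral_nonneg fun t => gstd_nonneg t

lemma Qfun_le_one (x : ℝ) : Qfun x ≤ 1 := by
  rw [Qfun_eq, ← gstd_integral]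
  exact setIntegral_le_integral gstd_integrable (Filter.Eventually.of_forall gstd_nonneg)

lemma Qfun_interval (x : ℝ) : ∫ t in (0:ℝ)..x, gstd t = 1 / 2 - Qfun x := by
  rw [← Qfun_zero, Qfun_eq, Qfun_eq]
  exact (intervalIntegral.integral_Ioi_sub_Ioi' gstd_integrable.integrableOn
    gstd_integrable.integrableOn).symm

lemma Qfun_exists {q : ℝ} (h0 : 0 < q) (h1 : q ≤ 1 / 2) : ∃ x, Qfun x = q := by
  have hc : Continuous Qfun := by
    have : Qfun = fun x => 1 / 2 - ∫ t in (0:ℝ)..x, gstd t := by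
      funext x; rw [Qfun_interval]; ring
    rw [this]
    exact continuous_const.sub
      (intervalIntegral.continuous_primitive (fun a b => gstd_integrable.intervalIntegrable) 0)
  have ht : Filter.Tendsto Qfun Filter.atTop (nhds 0) := by
    have h := intervalIntegral_tendsto_integral_Ioi (0:ℝ) gstd_integrable.integrableOn
      Filter.tendsto_id
    have h2 := h.const_sub (1/2)
    rw [← Qfun_eq, Qfun_zero] at h2
    simpa [Qfun_interval] using h2
  obtain ⟨X, hX, hX0⟩ := ((ht.eventually_lt_const h0).and (Filter.eventually_ge_atTop 0)).exists
  have := intermediate_value_Icc' hX0 hc.continuousOn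
  obtain ⟨x, -, hx⟩ := this ⟨hX.le, by rw [Qfun_zero]; exact h1⟩
  exact ⟨x, hx⟩

lemma gstd_window {x : ℝ} (hx : 0 ≤ x) :
    ∫ t, (Set.Ioo (-x) x).indicator gstd t = 1 - 2 * Qfun x := by
  rw [integral_indicator measurableSet_Ioo, ← integral_Ioc_eq_integral_Ioo,
    ← intervalIntegral.integral_of_le (by linarith),
    ← intervalIntegral.integral_add_adjacent_intervals (b := 0)
      gstd_integrable.intervalIntegrable gstd_integrable.intervalIntegrable]
  have : ∫ t in (-x)..0, gstd t = ∫ t in (0:ℝ)..x, gstd t := by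
    have h := intervalIntegral.integral_comp_neg (a := 0) (b := x) gstd
    rw [neg_zero] at h
    rw [← h]
    congr 1; funext t; simp [gstd]
  rw [this, Qfun_interval]; ring

/-! ### d-dimensional facts -/

variable {d : ℕ}

lemma gaussPdf_pos {β : ℝ} (hβ : 0 < β) (c t : EuclideanSpace ℝ (Fin d)) :
    0 < gaussPdf β c t := by unfold gaussPdf; positivity

lemma gaussPdf_cont (β : ℝ) :
    Continuous fun p : EuclideanSpace ℝ (Fin d) × EuclideanSpace ℝ (Fin d) =>
      gaussPdf β p.1 p.2 := by
  unfold gaussPdf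
  fun_prop

lemma gaussPdf_prod {β : ℝ} (hβ : 0 < β) (c t : EuclideanSpace ℝ (Fin d)) :
    gaussPdf β c t = ∏ i, (gstd ((t i - c i) / β) / β) := by
  unfold gaussPdf gstd
  have h1 : (2 * π * β ^ 2) ^ (-(d : ℝ) / 2) = ((√(2 * π))⁻¹ / β) ^ d := by
    have : (√(2 * π))⁻¹ / β = (2 * π * β ^ 2) ^ (-(1:ℝ) / 2) := by
      rw [neg_div, Real.rpow_neg (by positivity), ← Real.sqrt_eq_rpow,
        Real.sqrt_mul (by positivity : (0:ℝ) ≤ 2 * π) (β ^ 2), Real.sqrt_sq hβ.le, mul_inv,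
        div_eq_mul_inv]
    rw [this, ← Real.rpow_natCast (_ ^ (-(1:ℝ) / 2)) d, ← Real.rpow_mul (by positivity)]
    congr 1; ring
  have h2 : Real.exp (-‖t - c‖ ^ 2 / (2 * β ^ 2)) = ∏ i, Real.exp (-((t i - c i) / β) ^ 2 / 2) := by
    rw [← Real.exp_sum, EuclideanSpace.norm_sq_eq]
    congr 1
    rw [← Finset.sum_neg_distrib, Finset.sum_div]
    refine Finset.sum_congr rfl fun i _ => ?_
    simp only [PiLp.sub_apply, Real.norm_eq_abs, sq_abs]
    field_simp
  rw [h1, h2]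
  have : ∀ i, (√(2 * π))⁻¹ * Real.exp (-((t i - c i) / β) ^ 2 / 2) / β =
      ((√(2 * π))⁻¹ / β) * Real.exp (-((t i - c i) / β) ^ 2 / 2) := fun i => by ring
  simp_rw [this]
  rw [Finset.prod_mul_distrib, Finset.prod_const, Finset.card_univ, Fintype.card_fin]

/-- open cube around `c` of half-width `r` -/
def cell (c : EuclideanSpace ℝ (Fin d)) (r : ℝ) : Set (EuclideanSpace ℝ (Fin d)) :=
  {t | ∀ i, |t i - c i| < r}

lemma cell_meas (c : EuclideanSpace ℝ (Fin d)) (r : ℝ) : MeasurableSet (cell c r) := by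
  have : cell c r = ⋂ i, {t | |t i - c i| < r} := by ext; simp [cell]
  rw [this]
  refine MeasurableSet.iInter fun i => ?_
  refine (isOpen_lt ?_ continuous_const).measurableSet
  fun_prop

lemma integral_prod_euclid (F : Fin d → ℝ → ℝ) :
    ∫ t : EuclideanSpace ℝ (Fin d), ∏ i, F i (t i) = ∏ i, ∫ y, F i y := by
  rw [← integral_fintype_prod_volume_eq_prod,
    ← (PiLp.volume_preserving_ofLp (Fin d)).integral_comp
      (MeasurableEquiv.toLp 2 (Fin d → ℝ)).symm.measurableEmbedding]

lemma gaussPdf_cell {β x : ℝ} (hβ : 0 < β) (hx : 0 ≤ x) (c : EuclideanSpace ℝ (Fin d)) :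
    ∫ t, (cell c (β * x)).indicator (gaussPdf β c) t = (1 - 2 * Qfun x) ^ d := by
  have h : ∀ t, (cell c (β * x)).indicator (gaussPdf β c) t =
      ∏ i, ((Set.Ioo (-x) x).indicator gstd ((t i - c i) / β) / β) := by
    intro t
    have key : ∀ i, (t i - c i) / β ∈ Set.Ioo (-x) x ↔ |t i - c i| < β * x := by
      intro i
      rw [Set.mem_Ioo, abs_lt, lt_div_iff₀ hβ, div_lt_iff₀ hβ]
      constructor <;> rintro ⟨a, b⟩ <;> constructor <;> linarith
    by_cases ht : t ∈ cell c (β * x)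
    · rw [Set.indicator_of_mem ht, gaussPdf_prod hβ]
      refine Finset.prod_congr rfl fun i _ => ?_
      rw [Set.indicator_of_mem ((key i).2 (ht i))]
    · rw [Set.indicator_of_notMem ht]
      simp only [cell, Set.mem_ofPred_eq, not_forall] at ht
      obtain ⟨i, hi⟩ := ht
      refine (Finset.prod_eq_zero (Finset.mem_univ i) ?_).symm
      rw [Set.indicator_of_notMem (mt (key i).1 hi), zero_div]
  simp_rw [h]
  rw [integral_prod_euclid (fun i y => (Set.Ioo (-x) x).indicator gstd ((y - c i) / β) / β)]
  have : ∀ i, ∫ y, (Set.Ioo (-x) x).indicator gstd ((y - c i) / β) / β = 1 - 2 * Qfun x := by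
    intro i
    rw [integral_div,
      integral_sub_right_eq_self (fun y => (Set.Ioo (-x) x).indicator gstd (y / β)) (c i),
      Measure.integral_comp_div, gstd_window hx, abs_of_pos hβ, smul_eq_mul]
    field_simp
  simp [this]

lemma gaussPdf_integral {β : ℝ} (hβ : 0 < β) (c : EuclideanSpace ℝ (Fin d)) :
    ∫ t, gaussPdf β c t = 1 := by
  simp_rw [gaussPdf_prod hβ]
  rw [integral_prod_euclid (fun i y => gstd ((y - c i) / β) / β)]
  have : ∀ i, ∫ y, gstd ((y - c i) / β) / β = 1 := by
    intro i
    rw [integral_div,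
      integral_sub_right_eq_self (fun y => gstd (y / β)) (c i),
      Measure.integral_comp_div, gstd_integral, abs_of_pos hβ, smul_eq_mul]
    field_simp
  simp [this]

lemma gaussPdf_integrable {β : ℝ} (hβ : 0 < β) (c : EuclideanSpace ℝ (Fin d)) :
    Integrable (gaussPdf β c) :=
  Integrable.of_integral_ne_zero (by rw [gaussPdf_integral hβ]; exact one_ne_zero)

lemma exp_norm_integrable {b : ℝ} (hb : 0 < b) :
    Integrable fun t : EuclideanSpace ℝ (Fin d) => Real.exp (-b * ‖t‖ ^ 2) :=
  Integrable.of_integral_ne_zero (by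
    rw [GaussianFourier.integral_rexp_neg_mul_sq_norm hb]; positivity)

/-- lower and upper envelopes -/
noncomputable def gC (d : ℕ) (β : ℝ) : ℝ := (2 * π * β ^ 2) ^ (-(d : ℝ) / 2)

noncomputable def loE (β : ℝ) (t : EuclideanSpace ℝ (Fin d)) : ℝ :=
  gC d β * Real.exp (-((‖t‖ ^ 2 + d) / β ^ 2))

noncomputable def upE (β : ℝ) (t : EuclideanSpace ℝ (Fin d)) : ℝ :=
  gC d β * Real.exp (d / (2 * β ^ 2) - ‖t‖ ^ 2 / (4 * β ^ 2))

lemma gC_pos {β : ℝ} (hβ : 0 < β) : 0 < gC d β := by unfold gC; positivity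

lemma cube_norm {s : EuclideanSpace ℝ (Fin d)} (h : ∀ j, |s j| ≤ 1) : ‖s‖ ^ 2 ≤ d := by
  rw [EuclideanSpace.norm_sq_eq]
  calc ∑ i, ‖s i‖ ^ 2 ≤ ∑ i : Fin d, (1:ℝ) := by
        refine Finset.sum_le_sum fun i _ => ?_
        rw [Real.norm_eq_abs]
        have := h i
        have := abs_nonneg (s i)
        nlinarith
    _ = d := by simp

lemma gaussPdf_bounds {β : ℝ} (hβ : 0 < β) {s : EuclideanSpace ℝ (Fin d)}
    (h : ∀ j, |s j| ≤ 1) (t : EuclideanSpace ℝ (Fin d)) :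
    loE β t ≤ gaussPdf β s t ∧ gaussPdf β s t ≤ upE β t := by
  have hs := cube_norm h
  have hC := gC_pos (d := d) hβ
  have a1 : ‖t - s‖ ≤ ‖t‖ + ‖s‖ := norm_sub_le t s
  have a2 : ‖t‖ ≤ ‖t - s‖ + ‖s‖ := by simpa using norm_add_le (t - s) s
  have b1 : ‖t - s‖ ^ 2 ≤ 2 * ‖t‖ ^ 2 + 2 * ‖s‖ ^ 2 := by
    nlinarith [norm_nonneg (t - s), sq_nonneg (‖t‖ - ‖s‖)]
  have b2 : ‖t‖ ^ 2 ≤ 2 * ‖t - s‖ ^ 2 + 2 * ‖s‖ ^ 2 := by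
    nlinarith [norm_nonneg t, sq_nonneg (‖t - s‖ - ‖s‖)]
  unfold loE upE gaussPdf
  change _ ≤ gC d β * _ ∧ gC d β * _ ≤ _
  refine ⟨mul_le_mul_of_nonneg_left (Real.exp_le_exp.2 ?_) hC.le,
    mul_le_mul_of_nonneg_left (Real.exp_le_exp.2 ?_) hC.le⟩
  · rw [neg_div, neg_le_neg_iff, div_le_div_iff₀ (by positivity) (by positivity)]
    have : 0 < β ^ 2 := by positivity
    nlinarith
  · rw [le_sub_iff_add_le, ← sub_nonneg]
    have : (d:ℝ) / (2 * β ^ 2) - (-‖t - s‖ ^ 2 / (2 * β ^ 2) + ‖t‖ ^ 2 / (4 * β ^ 2)) =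
      (2 * d + 2 * ‖t - s‖ ^ 2 - ‖t‖ ^ 2) / (4 * β ^ 2) := by field_simp; ring
    rw [this]
    apply div_nonneg _ (by positivity)
    linarith

lemma envelope {β : ℝ} (hβ : 0 < β) : ∃ G : EuclideanSpace ℝ (Fin d) → ℝ, Integrable G ∧
    ∀ t v, loE β t ≤ v → v ≤ upE β t → |v * Real.log v| ≤ G t := by
  have hC := gC_pos (d := d) hβ
  set A : ℝ := |Real.log (gC d β)| + d / β ^ 2 + 8 with hA
  refine ⟨fun t => gC d β * Real.exp (d / (2 * β ^ 2)) * A *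
    Real.exp (-(1 / (8 * β ^ 2)) * ‖t‖ ^ 2), (exp_norm_integrable (by positivity)).const_mul _, ?_⟩
  intro t v h1 h2
  have hlo : 0 < loE β t := by unfold loE; positivity
  have hv : 0 < v := hlo.trans_le h1
  have l1 := Real.log_le_log hlo h1
  have l2 := Real.log_le_log hv h2
  unfold loE at l1
  unfold upE at l2
  rw [Real.log_mul hC.ne' (Real.exp_ne_zero _), Real.log_exp] at l1 l2
  set y := ‖t‖ ^ 2 / (8 * β ^ 2) with hy
  have hy0 : 0 ≤ y := by positivity
  have e1 : (‖t‖ ^ 2 + d) / β ^ 2 = 8 * y + d / β ^ 2 := by rw [hy]; field_simp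
  have e2 : d / (2 * β ^ 2) - ‖t‖ ^ 2 / (4 * β ^ 2) = d / (2 * β ^ 2) - y - y := by
    rw [hy]; field_simp; ring
  have e3 : -(1 / (8 * β ^ 2)) * ‖t‖ ^ 2 = - y := by rw [hy]; ring
  have e4 : (d:ℝ) / (2 * β ^ 2) = (d / β ^ 2) / 2 := by ring
  have hD : (0:ℝ) ≤ d / β ^ 2 := by positivity
  have hlog : |Real.log v| ≤ |Real.log (gC d β)| + d / β ^ 2 + 8 * y := by
    rw [abs_le]
    have := le_abs_self (Real.log (gC d β))
    have := neg_abs_le (Real.log (gC d β))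
    constructor
    · linarith
    · linarith
  have hexp : 1 + y ≤ Real.exp y := by linarith [Real.add_one_le_exp y]
  have hlog2 : |Real.log v| ≤ A * Real.exp y := by
    have : 0 ≤ |Real.log (gC d β)| + d / β ^ 2 := by positivity
    refine hlog.trans ?_
    rw [hA]
    nlinarith
  have hup : v ≤ gC d β * Real.exp (d / (2 * β ^ 2)) * Real.exp (-y) * Real.exp (-y) := by
    refine h2.trans (le_of_eq ?_)
    unfold upE
    rw [e2, sub_eq_add_neg, sub_eq_add_neg, Real.exp_add, Real.exp_add]; ring
  beta_reduce
  rw [abs_mul, abs_of_pos hv, e3]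
  calc v * |Real.log v| ≤ (gC d β * Real.exp (d / (2 * β ^ 2)) * Real.exp (-y) * Real.exp (-y)) *
        (A * Real.exp y) := mul_le_mul hup hlog2 (abs_nonneg _) (by positivity)
    _ = gC d β * Real.exp (d / (2 * β ^ 2)) * A * Real.exp (-y) * (Real.exp (-y) * Real.exp y) := by
        ring
    _ = _ := by rw [← Real.exp_add]; simp


lemma mix_bounds {β : ℝ} (hβ : 0 < β) {P : Measure (EuclideanSpace ℝ (Fin d))}
    (hP : P ∈ cubeClass d) (t : EuclideanSpace ℝ (Fin d)) :
    loE β t ≤ ∫ s, gaussPdf β s t ∂P ∧ ∫ s, gaussPdf β s t ∂P ≤ upE β t := by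
  obtain ⟨hp, hs⟩ := hP
  have hb : ∀ᵐ s ∂P, loE β t ≤ gaussPdf β s t ∧ gaussPdf β s t ≤ upE β t := by
    filter_upwards [hs] with s h using gaussPdf_bounds hβ h t
  have hcont : Continuous fun s => gaussPdf β s t := by
    unfold gaussPdf; fun_prop
  have hi : Integrable (fun s => gaussPdf β s t) P := by
    refine Integrable.of_bound hcont.aestronglyMeasurable (upE β t) ?_
    filter_upwards [hb] with s h
    rw [Real.norm_eq_abs, abs_of_pos (gaussPdf_pos hβ s t)]; exact h.2
  constructor
  · have := integral_mono_ae (integrable_const (loE β t)) hi (hb.mono fun s h => h.1)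
    simpa using this
  · have := integral_mono_ae hi (integrable_const (upE β t)) (hb.mono fun s h => h.2)
    simpa using this

lemma emp_bounds {β : ℝ} (hβ : 0 < β) {ι : Type*} [Fintype ι] [Nonempty ι]
    {s : ι → EuclideanSpace ℝ (Fin d)}
    (hs : ∀ i j, |s i j| ≤ 1) (t : EuclideanSpace ℝ (Fin d)) :
    loE β t ≤ (Fintype.card ι : ℝ)⁻¹ * ∑ i, gaussPdf β (s i) t ∧
      (Fintype.card ι : ℝ)⁻¹ * ∑ i, gaussPdf β (s i) t ≤ upE β t := by
  have hn : (0:ℝ) < Fintype.card ι := by exact_mod_cast Fintype.card_pos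
  have h1 : ∑ i : ι, loE β t ≤ ∑ i, gaussPdf β (s i) t :=
    Finset.sum_le_sum fun i _ => (gaussPdf_bounds hβ (hs i) t).1
  have h2 : ∑ i, gaussPdf β (s i) t ≤ ∑ i : ι, upE β t :=
    Finset.sum_le_sum fun i _ => (gaussPdf_bounds hβ (hs i) t).2
  simp only [Finset.sum_const, Finset.card_univ, nsmul_eq_mul] at h1 h2
  rw [inv_mul_eq_div, le_div_iff₀ hn, div_le_iff₀ hn]
  constructor <;> linarith

lemma diffEnt_bound {β : ℝ} {G : EuclideanSpace ℝ (Fin d) → ℝ} (hG : Integrable G)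
    (hG2 : ∀ t v, loE β t ≤ v → v ≤ upE β t → |v * Real.log v| ≤ G t)
    {g : EuclideanSpace ℝ (Fin d) → ℝ} (hg : ∀ t, loE β t ≤ g t ∧ g t ≤ upE β t) :
    |diffEnt g| ≤ ∫ t, G t := by
  unfold diffEnt
  rw [abs_neg, ← Real.norm_eq_abs]
  exact norm_integral_le_of_norm_le hG
    (Filter.Eventually.of_forall fun t => hG2 t _ (hg t).1 (hg t).2)

lemma ae_cube {n : ℕ} {P : Measure (EuclideanSpace ℝ (Fin d))}
    (hP : P ∈ cubeClass d) :
    ∀ᵐ s ∂(Measure.pi fun _ : Fin n => P), ∀ i j, |s i j| ≤ 1 := by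
  obtain ⟨hp, hs⟩ := hP
  rw [ae_all_iff]
  intro i
  exact (Measure.quasiMeasurePreserving_eval (fun _ : Fin n => P) i).ae hs

lemma emp_bounds_fin {n : ℕ} (hn : 0 < n) {β : ℝ} (hβ : 0 < β)
    {s : Fin n → EuclideanSpace ℝ (Fin d)}
    (hs : ∀ i j, |s i j| ≤ 1) (t : EuclideanSpace ℝ (Fin d)) :
    loE β t ≤ (n : ℝ)⁻¹ * ∑ i, gaussPdf β (s i) t ∧
      (n : ℝ)⁻¹ * ∑ i, gaussPdf β (s i) t ≤ upE β t := by
  have : Nonempty (Fin n) := ⟨⟨0, hn⟩⟩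
  simpa using emp_bounds hβ hs t

lemma bias_bdd {n : ℕ} (hn : 0 < n) {β : ℝ} (hβ : 0 < β) :
    BddAbove (Set.range fun P : cubeClass d => |spBias d n β P|) := by
  obtain ⟨G, hG, hG2⟩ := envelope (d := d) hβ
  refine ⟨(∫ t, G t) + ∫ t, G t, ?_⟩
  rintro _ ⟨⟨P, hP⟩, rfl⟩
  have := hP.1
  simp only [spBias]
  refine (abs_sub _ _).trans (add_le_add ?_ ?_)
  · exact diffEnt_bound hG hG2 (mix_bounds hβ hP)
  · have := norm_integral_le_of_norm_le_const (μ := Measure.pi fun _ : Fin n => P)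
      (f := fun s => diffEnt (fun t => (n : ℝ)⁻¹ * ∑ i, gaussPdf β (s i) t)) (C := ∫ t, G t)
      (by
        filter_upwards [ae_cube hP] with s hs
        exact diffEnt_bound hG hG2 (emp_bounds_fin hn hβ hs))
    simpa using this

lemma gauss_ent {β : ℝ} (c : EuclideanSpace ℝ (Fin d)) :
    ∫ t, gaussPdf β c t * Real.log (gaussPdf β c t) = - diffEnt (gaussPdf (d := d) β 0) := by
  unfold diffEnt
  rw [neg_neg]
  have h : ∀ t, gaussPdf β c t = gaussPdf β 0 (t - c) := by intro t; simp [gaussPdf]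
  simp_rw [h]
  exact integral_sub_right_eq_self (fun t => gaussPdf β 0 t * Real.log (gaussPdf β 0 t)) c

lemma ent_integrable {β : ℝ} (hβ : 0 < β) {g : EuclideanSpace ℝ (Fin d) → ℝ}
    (hc : Continuous g) (hg : ∀ t, loE β t ≤ g t ∧ g t ≤ upE β t) :
    Integrable fun t => g t * Real.log (g t) := by
  obtain ⟨G, hG, hG2⟩ := envelope (d := d) hβ
  refine hG.mono' ?_ (Filter.Eventually.of_forall fun t => hG2 t _ (hg t).1 (hg t).2)
  exact (hc.measurable.mul (Real.measurable_log.comp hc.measurable)).aestronglyMeasurable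

lemma gaussPdf_cont2 (β : ℝ) (c : EuclideanSpace ℝ (Fin d)) : Continuous (gaussPdf β c) := by
  unfold gaussPdf; fun_prop

lemma mix_cont {ι : Type*} [Fintype ι] (β a : ℝ) (s : ι → EuclideanSpace ℝ (Fin d)) :
    Continuous fun t => a * ∑ i, gaussPdf β (s i) t :=
  continuous_const.mul (continuous_finsetSum _ fun i _ => gaussPdf_cont2 β (s i))

lemma emp_ent_le {n : ℕ} (hn : 0 < n) {β : ℝ} (hβ : 0 < β)
    {s : Fin n → EuclideanSpace ℝ (Fin d)} (hs : ∀ i j, |s i j| ≤ 1) :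
    diffEnt (fun t => (n : ℝ)⁻¹ * ∑ i, gaussPdf β (s i) t) ≤
      Real.log n + diffEnt (gaussPdf (d := d) β 0) := by
  have hn' : (0:ℝ) < n := by exact_mod_cast hn
  have hI := ent_integrable hβ (mix_cont β (n:ℝ)⁻¹ s) (emp_bounds_fin hn hβ hs)
  have hIi : ∀ i, Integrable fun t => gaussPdf β (s i) t * Real.log (gaussPdf β (s i) t) :=
    fun i => ent_integrable hβ (gaussPdf_cont2 β (s i)) (gaussPdf_bounds hβ (hs i))
  have hJi : ∀ i, Integrable fun t => gaussPdf β (s i) t * Real.log (gaussPdf β (s i) t)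
      - gaussPdf β (s i) t * Real.log n :=
    fun i => (hIi i).sub ((gaussPdf_integrable hβ (s i)).mul_const _)
  have hpt : ∀ t, (n:ℝ)⁻¹ * ∑ i, (gaussPdf β (s i) t * Real.log (gaussPdf β (s i) t)
      - gaussPdf β (s i) t * Real.log n) ≤
      ((n : ℝ)⁻¹ * ∑ i, gaussPdf β (s i) t) *
        Real.log ((n : ℝ)⁻¹ * ∑ i, gaussPdf β (s i) t) := by
    intro t
    rw [mul_assoc, Finset.sum_mul]
    refine mul_le_mul_of_nonneg_left (Finset.sum_le_sum fun i _ => ?_) (by positivity)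
    have hp := gaussPdf_pos hβ (s i) t
    rw [← mul_sub]
    refine mul_le_mul_of_nonneg_left ?_ hp.le
    rw [← Real.log_div hp.ne' hn'.ne']
    refine Real.log_le_log (by positivity) ?_
    rw [div_eq_inv_mul]
    refine mul_le_mul_of_nonneg_left ?_ (by positivity)
    exact Finset.single_le_sum (f := fun i => gaussPdf β (s i) t)
      (fun i _ => (gaussPdf_pos hβ (s i) t).le) (Finset.mem_univ i)
  have hm := integral_mono ((integrable_finsetSum Finset.univ fun i _ => hJi i).const_mul _) hI hpt
  rw [integral_const_mul, integral_finsetSum _ (fun i _ => hJi i)] at hm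
  have he : ∀ i, ∫ t, (gaussPdf β (s i) t * Real.log (gaussPdf β (s i) t)
      - gaussPdf β (s i) t * Real.log n) = - diffEnt (gaussPdf (d := d) β 0) - Real.log n := by
    intro i
    rw [integral_sub (hIi i) ((gaussPdf_integrable hβ (s i)).mul_const _), gauss_ent,
      integral_mul_const, gaussPdf_integral hβ, one_mul]
  simp_rw [he] at hm
  simp only [Finset.sum_const, Finset.card_univ, Fintype.card_fin, nsmul_eq_mul] at hm
  rw [inv_mul_cancel_left₀ hn'.ne'] at hm
  unfold diffEnt at hm ⊢
  linarith

lemma emp_mean_le {n : ℕ} (hn : 0 < n) {β : ℝ} (hβ : 0 < β)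
    {P : Measure (EuclideanSpace ℝ (Fin d))} (hP : P ∈ cubeClass d) :
    ∫ s : Fin n → EuclideanSpace ℝ (Fin d),
      diffEnt (fun t => (n : ℝ)⁻¹ * ∑ i, gaussPdf β (s i) t) ∂(Measure.pi fun _ => P) ≤
      Real.log n + diffEnt (gaussPdf (d := d) β 0) := by
  have := hP.1
  obtain ⟨G, hG, hG2⟩ := envelope (d := d) hβ
  have hc : Continuous fun p : (Fin n → EuclideanSpace ℝ (Fin d)) × EuclideanSpace ℝ (Fin d) =>
      (n : ℝ)⁻¹ * ∑ i, gaussPdf β (p.1 i) p.2 := by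
    refine continuous_const.mul (continuous_finsetSum _ fun i _ => ?_)
    unfold gaussPdf; fun_prop
  have hm : StronglyMeasurable fun s : Fin n → EuclideanSpace ℝ (Fin d) =>
      diffEnt (fun t => (n : ℝ)⁻¹ * ∑ i, gaussPdf β (s i) t) := by
    unfold diffEnt
    refine StronglyMeasurable.neg ?_
    exact StronglyMeasurable.integral_prod_right'
      (hc.measurable.mul (Real.measurable_log.comp hc.measurable)).stronglyMeasurable
  have hi : Integrable (fun s : Fin n → EuclideanSpace ℝ (Fin d) =>
      diffEnt (fun t => (n : ℝ)⁻¹ * ∑ i, gaussPdf β (s i) t)) (Measure.pi fun _ => P) := by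
    refine Integrable.of_bound hm.aestronglyMeasurable (∫ t, G t) ?_
    filter_upwards [ae_cube hP] with s hs
    exact diffEnt_bound hG hG2 (emp_bounds_fin hn hβ hs)
  have := integral_mono_ae hi (integrable_const (Real.log n + diffEnt (gaussPdf (d := d) β 0)))
    (by filter_upwards [ae_cube hP] with s hs using emp_ent_le hn hβ hs)
  simpa using this

/-- Fano-type bound through the Gibbs variational principle. -/
lemma fano {ι : Type*} [Fintype ι] [Nonempty ι] {β x ε : ℝ} (hβ : 0 < β) (hx : 0 ≤ x)
    (hε0 : 0 < ε) (hε1 : ε < 1) (hQ : (1 - 2 * Qfun x) ^ d = 1 - ε)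
    {c : ι → EuclideanSpace ℝ (Fin d)} (hc : ∀ i j, |c i j| ≤ 1)
    (hdisj : ∀ i i' t, t ∈ cell (c i) (β * x) → t ∈ cell (c i') (β * x) → i = i') :
    diffEnt (gaussPdf (d := d) β 0) + ((1 - ε) * Real.log (Fintype.card ι) - binEnt ε) ≤
      diffEnt (fun t => (Fintype.card ι : ℝ)⁻¹ * ∑ i, gaussPdf β (c i) t) := by
  classical
  set M : ℝ := (Fintype.card ι : ℝ) with hM
  have hM0 : 0 < M := by rw [hM]; exact_mod_cast Fintype.card_pos
  set A := fun i => cell (c i) (β * x) with hA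
  set q : ι → EuclideanSpace ℝ (Fin d) → ℝ := fun i t => if t ∈ A i then 1 - ε else ε / M with hq
  set f : EuclideanSpace ℝ (Fin d) → ℝ := fun t => M⁻¹ * ∑ i, gaussPdf β (c i) t with hf
  have hqpos : ∀ i t, 0 < q i t := by
    intro i t; simp only [hq]; split_ifs
    · linarith
    · positivity
  have hqsum : ∀ t, ∑ i, q i t ≤ 1 := by
    intro t
    have h1 : ∀ i, q i t ≤ (if t ∈ A i then 1 - ε else 0) + ε / M := by
      intro i; simp only [hq]
      have : 0 < ε / M := by positivity
      split_ifs <;> linarith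
    have h2 : ∑ i, (if t ∈ A i then 1 - ε else 0) ≤ 1 - ε := by
      by_cases h : ∃ i, t ∈ A i
      · obtain ⟨i, hi⟩ := h
        rw [Finset.sum_eq_single i]
        · rw [if_pos hi]
        · intro j _ hj
          rw [if_neg]
          intro h; exact hj (hdisj j i t h hi)
        · simp
      · push Not at h
        rw [Finset.sum_eq_zero (fun i _ => if_neg (h i))]
        linarith
    calc ∑ i, q i t ≤ ∑ i, ((if t ∈ A i then 1 - ε else 0) + ε / M) :=
          Finset.sum_le_sum fun i _ => h1 i
      _ = ∑ i, (if t ∈ A i then 1 - ε else 0) + ε := by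
          rw [Finset.sum_add_distrib]
          simp only [Finset.sum_const, Finset.card_univ, nsmul_eq_mul]
          rw [← hM]; field_simp
      _ ≤ 1 := by linarith
  have hfpos : ∀ t, 0 < f t := by
    intro t
    exact mul_pos (by positivity)
      (Finset.sum_pos (fun i _ => gaussPdf_pos hβ _ _) Finset.univ_nonempty)
  have hfsum : ∀ t, ∑ i, gaussPdf β (c i) t = M * f t := by
    intro t; simp only [hf]; field_simp
  have hlq : ∀ i t, gaussPdf β (c i) t * Real.log (M * q i t) =
      gaussPdf β (c i) t * Real.log ε + (A i).indicator (gaussPdf β (c i)) t *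
        (Real.log M + Real.log (1 - ε) - Real.log ε) := by
    intro i t
    by_cases h : t ∈ A i
    · rw [Set.indicator_of_mem h]
      simp only [hq, if_pos h]
      rw [Real.log_mul hM0.ne' (by linarith)]; ring
    · rw [Set.indicator_of_notMem h]
      simp only [hq, if_neg h]
      rw [mul_div_cancel₀ _ hM0.ne']; ring
  have hIi : ∀ i, Integrable fun t => gaussPdf β (c i) t * Real.log (gaussPdf β (c i) t) :=
    fun i => ent_integrable hβ (gaussPdf_cont2 β (c i)) (gaussPdf_bounds hβ (hc i))
  have hIf : Integrable fun t => f t * Real.log (f t) :=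
    ent_integrable hβ (mix_cont β M⁻¹ c) (emp_bounds hβ hc)
  have hInd : ∀ i, Integrable ((A i).indicator (gaussPdf β (c i))) :=
    fun i => (gaussPdf_integrable hβ (c i)).indicator (cell_meas _ _)
  have hL1 : ∀ i, Integrable fun t => gaussPdf β (c i) t * Real.log (M * q i t) := by
    intro i
    simp_rw [hlq]
    exact ((gaussPdf_integrable hβ (c i)).mul_const _).add ((hInd i).mul_const _)
  have hL2 : ∀ i, ∫ t, gaussPdf β (c i) t * Real.log (M * q i t) =
      (1 - ε) * Real.log M - binEnt ε := by
    intro i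
    simp_rw [hlq]
    rw [integral_add ((gaussPdf_integrable hβ (c i)).mul_const _) ((hInd i).mul_const _),
      integral_mul_const, integral_mul_const, gaussPdf_integral hβ, gaussPdf_cell hβ hx, hQ]
    unfold binEnt; ring
  have hpt : ∀ t, M * (f t * Real.log (f t)) ≤
      ∑ i, (gaussPdf β (c i) t * Real.log (gaussPdf β (c i) t) -
        gaussPdf β (c i) t * Real.log (M * q i t)) := by
    intro t
    have h1 : ∀ i, gaussPdf β (c i) t - M * f t * q i t ≤
        gaussPdf β (c i) t * Real.log (gaussPdf β (c i) t) -
        gaussPdf β (c i) t * Real.log (M * q i t) - gaussPdf β (c i) t * Real.log (f t) := by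
      intro i
      have hp := gaussPdf_pos hβ (c i) t
      have hMq : 0 < M * q i t := mul_pos hM0 (hqpos i t)
      have h := Real.one_sub_inv_le_log_of_pos
        (div_pos hp (mul_pos hMq (hfpos t)))
      rw [Real.log_div hp.ne' (mul_pos hMq (hfpos t)).ne', Real.log_mul hMq.ne' (hfpos t).ne',
        inv_div] at h
      have h' := mul_le_mul_of_nonneg_left h hp.le
      have e : gaussPdf β (c i) t * (1 - M * q i t * f t / gaussPdf β (c i) t) =
        gaussPdf β (c i) t - M * f t * q i t := by field_simp
      rw [e] at h'
      linarith
    have h2 := Finset.sum_le_sum fun i (_ : i ∈ Finset.univ) => h1 i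
    rw [Finset.sum_sub_distrib, Finset.sum_sub_distrib, ← Finset.mul_sum, ← Finset.sum_mul,
      hfsum] at h2
    have h3 : M * f t * ∑ i, q i t ≤ M * f t * 1 :=
      mul_le_mul_of_nonneg_left (hqsum t) (mul_pos hM0 (hfpos t)).le
    linarith
  have hJ : ∀ i, Integrable fun t => gaussPdf β (c i) t * Real.log (gaussPdf β (c i) t) -
        gaussPdf β (c i) t * Real.log (M * q i t) := fun i => (hIi i).sub (hL1 i)
  have hm := integral_mono (hIf.const_mul M)
    (integrable_finsetSum Finset.univ fun i _ => hJ i) hpt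
  rw [integral_const_mul, integral_finsetSum _ (fun i _ => hJ i)] at hm
  have he : ∀ i, ∫ t, (gaussPdf β (c i) t * Real.log (gaussPdf β (c i) t) -
        gaussPdf β (c i) t * Real.log (M * q i t)) =
      - diffEnt (gaussPdf (d := d) β 0) - ((1 - ε) * Real.log M - binEnt ε) := by
    intro i
    rw [integral_sub (hIi i) (hL1 i), gauss_ent, hL2]
  simp_rw [he] at hm
  simp only [Finset.sum_const, Finset.card_univ, nsmul_eq_mul] at hm
  rw [← hM] at hm
  have hm' := le_of_mul_le_mul_left hm hM0
  change _ ≤ - ∫ t, f t * Real.log (f t)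
  linarith

/-- grid of centroids -/
noncomputable def centroid (k : ℕ) (j : Fin d → Fin k) : EuclideanSpace ℝ (Fin d) :=
  WithLp.toLp 2 fun i => -1 + (2 * ((j i : ℕ) : ℝ) + 1) / k

lemma centroid_cube {k : ℕ} (j : Fin d → Fin k) (i : Fin d) : |centroid k j i| ≤ 1 := by
  have hk : (0:ℝ) < k := by exact_mod_cast (Fin.pos (j i))
  have h1 : ((j i : ℕ) : ℝ) + 1 ≤ k := by exact_mod_cast (j i).2
  have h0 : (0:ℝ) ≤ ((j i : ℕ) : ℝ) := by positivity
  simp only [centroid]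
  rw [abs_le]
  constructor
  · have : 0 ≤ (2 * ((j i : ℕ) : ℝ) + 1) / k := by positivity
    linarith
  · have : (2 * ((j i : ℕ) : ℝ) + 1) / k ≤ 2 := by
      rw [div_le_iff₀ hk]; linarith
    linarith

lemma centroid_disj {k : ℕ} {r : ℝ} (hr : r ≤ 1 / k) (j j' : Fin d → Fin k)
    (t : EuclideanSpace ℝ (Fin d)) (h : t ∈ cell (centroid k j) r)
    (h' : t ∈ cell (centroid k j') r) : j = j' := by
  funext i
  have hk : (0:ℝ) < k := by exact_mod_cast (Fin.pos (j i))
  have a := abs_lt.1 ((h i).trans_le hr)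
  have a' := abs_lt.1 ((h' i).trans_le hr)
  simp only [centroid] at a a'
  have e : ∀ y : ℝ, -1 + (2 * y + 1) / k = (2 * y + 1) / k - 1 := fun y => by ring
  have b1 : (2 * ((j i : ℕ) : ℝ) + 1) / k < (2 * ((j' i : ℕ) : ℝ) + 1) / k + 2 / k := by
    have : (2:ℝ) / k = 1 / k + 1 / k := by ring
    linarith [a.1, a.2, a'.1, a'.2]
  have b2 : (2 * ((j' i : ℕ) : ℝ) + 1) / k < (2 * ((j i : ℕ) : ℝ) + 1) / k + 2 / k := by
    have : (2:ℝ) / k = 1 / k + 1 / k := by ring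
    linarith [a.1, a.2, a'.1, a'.2]
  rw [← add_div, div_lt_div_iff_of_pos_right hk] at b1 b2
  have c1 : ((j i : ℕ) : ℝ) < (j' i : ℕ) + 1 := by linarith
  have c2 : ((j' i : ℕ) : ℝ) < (j i : ℕ) + 1 := by linarith
  have c1' : (j i : ℕ) < (j' i : ℕ) + 1 := by exact_mod_cast c1
  have c2' : (j' i : ℕ) < (j i : ℕ) + 1 := by exact_mod_cast c2
  exact Fin.ext (by omega)

/-- uniform distribution on a finite family of points -/
noncomputable def unif {ι : Type*} [Fintype ι] (c : ι → EuclideanSpace ℝ (Fin d)) :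
    Measure (EuclideanSpace ℝ (Fin d)) :=
  (Fintype.card ι : ENNReal)⁻¹ • ∑ i, Measure.dirac (c i)

lemma unif_mem {ι : Type*} [Fintype ι] [Nonempty ι] {c : ι → EuclideanSpace ℝ (Fin d)}
    (hc : ∀ i j, |c i j| ≤ 1) : unif c ∈ cubeClass d := by
  constructor
  · constructor
    simp only [unif, Measure.smul_apply, Measure.finsetSum_apply, measure_univ, smul_eq_mul,
      Finset.sum_const, Finset.card_univ, nsmul_eq_mul, mul_one]
    exact ENNReal.inv_mul_cancel (by simp) (by simp)
  · refine Measure.ae_smul_measure ?_ _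
    rw [ae_iff, Measure.finsetSum_apply]
    refine Finset.sum_eq_zero fun i _ => ?_
    rw [← ae_iff, ae_dirac_eq]
    exact hc i

lemma unif_mix {ι : Type*} [Fintype ι] (c : ι → EuclideanSpace ℝ (Fin d)) (β : ℝ)
    (t : EuclideanSpace ℝ (Fin d)) :
    ∫ s, gaussPdf β s t ∂(unif c) = (Fintype.card ι : ℝ)⁻¹ * ∑ i, gaussPdf β (c i) t := by
  unfold unif
  rw [integral_smul_measure, integral_finsetSum_measure]
  · simp
  · intro i _
    exact integrable_dirac (by simp)

lemma binEnt_nonneg {ε : ℝ} (h0 : 0 ≤ ε) (h1 : ε ≤ 1) : 0 ≤ binEnt ε := by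
  unfold binEnt
  have := Real.mul_log_nonpos h0 h1
  have := Real.mul_log_nonpos (x := 1 - ε) (by linarith) (by linarith)
  linarith

end

/-- Lower bound on the worst-case bias of the plug-in entropy estimator:
`sup_{P ∈ F_d} |h(P∗φ_β) − E h(P̂_{S^n}∗φ_β)| ≥ log(k_*^{d(1−ε)}/n) − H_b(ε)`
where `k_* = ⌊1/(β Q^{−1}((1 − (1−ε)^{1/d})/2))⌋`. -/
theorem spBias_lower_bound (d n : ℕ) (hd : 1 ≤ d) (hn : 0 < n) (β ε : ℝ) (hβ : 0 < β)
    (hε₁ : 1 - (1 - 2 * Qfun (1 / (2 * β))) ^ d < ε) (hε₂ : ε ≤ 1)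
    (kstar : ℕ)
    (hk : kstar = ⌊1 / (β * Function.invFun Qfun ((1 - (1 - ε) ^ ((1 : ℝ) / d)) / 2))⌋₊) :
    (⨆ P : cubeClass d, |spBias d n β P|) ≥
      Real.log ((kstar : ℝ) ^ ((d : ℝ) * (1 - ε)) / n) - binEnt ε := by
  have hn' : (0:ℝ) < n := by exact_mod_cast hn
  have hn1 : (1:ℝ) ≤ n := by exact_mod_cast hn
  have hlogn : 0 ≤ Real.log n := Real.log_nonneg hn1
  have hε0 : 0 < ε := by
    have h : |(1 - 2 * Qfun (1 / (2 * β))) ^ d| ≤ 1 := by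
      rw [abs_pow]
      refine pow_le_one₀ (abs_nonneg _) (abs_le.2 ?_)
      have := Qfun_nonneg (1 / (2 * β))
      have := Qfun_le_one (1 / (2 * β))
      constructor <;> linarith
    linarith [(abs_le.1 h).2]
  have hbin := binEnt_nonneg hε0.le hε₂
  have hsup0 : 0 ≤ ⨆ P : cubeClass d, |spBias d n β P| := Real.iSup_nonneg fun P => abs_nonneg _
  rcases hε₂.eq_or_lt with rfl | hε1
  · have : Real.log ((kstar : ℝ) ^ ((d : ℝ) * (1 - 1)) / n) = - Real.log n := by
      simp
    rw [this]; linarith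
  rcases Nat.eq_zero_or_pos kstar with hk0 | hkpos
  · have hd0 : (d:ℝ) * (1 - ε) ≠ 0 :=
      (mul_pos (by exact_mod_cast hd) (by linarith)).ne'
    rw [hk0, Nat.cast_zero, Real.zero_rpow hd0, zero_div, Real.log_zero]
    linarith
  have hd' : (0:ℝ) < d := by exact_mod_cast hd
  have h1ε : 0 < 1 - ε := by linarith
  set w : ℝ := (1 - ε) ^ ((1 : ℝ) / d) with hw
  have hw0 : 0 < w := Real.rpow_pos_of_pos h1ε _
  have hw1 : w < 1 := Real.rpow_lt_one h1ε.le (by linarith) (by positivity)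
  have hwd : w ^ d = 1 - ε := by
    rw [hw, ← Real.rpow_natCast, ← Real.rpow_mul h1ε.le, one_div_mul_cancel hd'.ne', Real.rpow_one]
  set x := Function.invFun Qfun ((1 - w) / 2) with hxdef
  have hQx : Qfun x = (1 - w) / 2 :=
    Function.invFun_eq (Qfun_exists (by linarith) (by linarith))
  have hfl : (kstar : ℝ) ≤ 1 / (β * x) := by
    rw [hk] at hkpos ⊢
    exact Nat.floor_le (le_of_lt (lt_of_lt_of_le one_pos (Nat.floor_pos.1 hkpos)))
  have hk' : (0:ℝ) < kstar := by exact_mod_cast hkpos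
  have hβx : 0 < β * x := one_div_pos.1 (hk'.trans_le hfl)
  have hx : 0 < x := (mul_pos_iff_of_pos_left hβ).1 hβx
  have hr : β * x ≤ 1 / kstar := by
    rw [le_div_iff₀ hk']
    rwa [le_div_iff₀ hβx, mul_comm] at hfl
  have hQ : (1 - 2 * Qfun x) ^ d = 1 - ε := by
    rw [hQx, ← hwd]; ring
  have : Nonempty (Fin kstar) := ⟨⟨0, hkpos⟩⟩
  have hfano := fano (d := d) (c := fun j : Fin d → Fin kstar => centroid kstar j) hβ hx.le hε0 hε1
    hQ (fun j i => centroid_cube j i) (fun j j' t h h' => centroid_disj hr j j' t h h')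
  have hmem : unif (fun j : Fin d → Fin kstar => centroid kstar j) ∈ cubeClass d :=
    unif_mem fun j i => centroid_cube j i
  have hbias := le_ciSup (bias_bdd (d := d) hn hβ) ⟨_, hmem⟩
  have hmean := emp_mean_le hn hβ hmem
  have hcard : Real.log (Fintype.card (Fin d → Fin kstar) : ℝ) = d * Real.log kstar := by
    simp
  rw [hcard] at hfano
  have hrhs : Real.log ((kstar : ℝ) ^ ((d : ℝ) * (1 - ε)) / n) =
      (1 - ε) * (d * Real.log kstar) - Real.log n := by
    rw [Real.log_div (Real.rpow_pos_of_pos hk' _).ne' hn'.ne', Real.log_rpow hk']; ring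
  rw [hrhs]
  refine le_trans ?_ hbias
  refine le_trans ?_ (le_abs_self _)
  simp only [spBias, unif_mix]
  linarith
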